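/- arXiv:2006.16576 — 2 statements merged into one kernel-verified Lean document; each statement's English description precedes it below -/
import Mathlib

section
/- If β ∈ Q with σ(β) ∉ Q has finite Levi order, then q^σ(β) ≤ 1 − ξ(β). -/
open RealInnerProductSpace

variable {V : Type*} [NormedAddCommGroup V] [InnerProductSpace ℝ V]

/-- `R` is a reduced crystallographic root system in `V`. -/
def IsRootSystem (R : Set V) : Prop :=
  R.Finite ∧ (0 : V) ∉ R ∧
    (∀ α ∈ R, ∀ β ∈ R,
      (∃ n : ℤ, 2 * ⟪β, α⟫ / ⟪α, α⟫ = (n : ℝ)) ∧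
        β - (2 * ⟪β, α⟫ / ⟪α, α⟫) • α ∈ R) ∧
    ∀ α ∈ R, ∀ t : ℝ, t • α ∈ R → t = 1 ∨ t = -1

/-- The partial sum `β + α₁ + ⋯ + α_h` of the first `h` terms of a sequence. -/
def partialSum (β : V) {k : ℕ} (α : Fin k → V) (h : ℕ) : V :=
  β + ∑ i ∈ Finset.univ.filter (fun i : Fin k => (i : ℕ) < h), α i

/-- `α` is a Levi chain of length `k` for `β`: all `σ(αᵢ) ∈ Q`, all partial sums
`β + α₁ + ⋯ + α_h` (`1 ≤ h ≤ k`) are roots, and the final sum `γ` satisfies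
`γ ∉ Q` and `σ(γ) ∉ Q`. -/
def IsLeviChain (R Q : Set V) (σ : V →ₗ[ℝ] V) (β : V) {k : ℕ} (α : Fin k → V) : Prop :=
  (∀ i, α i ∈ R ∧ σ (α i) ∈ Q) ∧
    (∀ h : ℕ, 1 ≤ h → h ≤ k → partialSum β α h ∈ R) ∧
    partialSum β α k ∉ Q ∧ σ (partialSum β α k) ∉ Q

/-- The Levi order `q^σ(β)`: the minimal length of a Levi chain for `β`,
or `⊤` if no Levi chain for `β` exists. -/
noncomputable def leviOrder (R Q : Set V) (σ : V →ₗ[ℝ] V) (β : V) : ℕ∞ :=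
  sInf {m : ℕ∞ | ∃ (k : ℕ) (α : Fin k → V), m = (k : ℕ∞) ∧ IsLeviChain R Q σ β α}

/-- Two roots at an obtuse angle sum to a root or to zero. -/
theorem IsRootSystem.add_mem_or_eq_zero {R : Set V} (hR : IsRootSystem R) {α β : V}
    (hα : α ∈ R) (hβ : β ∈ R) (h : ⟪α, β⟫ < 0) : α + β ∈ R ∨ α + β = 0 := by
  obtain ⟨-, h0, hrefl, -⟩ := hR
  have key : ∀ α ∈ R, ∀ β ∈ R, ⟪β, α⟫ < 0 → β + α ∈ R ∨ ⟪β, α⟫ ≤ -⟪α, α⟫ := by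
    intro α hα β hβ h
    obtain ⟨⟨n, hn⟩, hmem⟩ := hrefl α hα β hβ
    have hpos : 0 < ⟪α, α⟫ := real_inner_self_pos.2 fun h' => h0 (h' ▸ hα)
    rw [hn] at hmem
    rw [div_eq_iff hpos.ne'] at hn
    have hneg : n < 0 := by
      have : (n : ℝ) < 0 := by by_contra! hc; nlinarith
      exact_mod_cast this
    rcases eq_or_ne n (-1) with rfl | hne
    · left
      simpa using hmem
    · right
      have : (n : ℝ) ≤ -2 := by exact_mod_cast (by lia : n ≤ -2)
      nlinarith
  have h' : ⟪β, α⟫ < 0 := by rwa [real_inner_comm]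
  rcases key α hα β hβ h' with h1 | h1
  · left
    rwa [add_comm]
  rcases key β hβ α hα h with h2 | h2
  · exact Or.inl h2
  right
  rw [← real_inner_self_nonpos]
  simp only [inner_add_left, inner_add_right]
  linarith

theorem IsRootSystem.neg_mem {R : Set V} (hR : IsRootSystem R) {α : V} (hα : α ∈ R) :
    -α ∈ R := by
  obtain ⟨-, h0, hrefl, -⟩ := hR
  have hpos : 0 < ⟪α, α⟫ := real_inner_self_pos.2 fun h' => h0 (h' ▸ hα)
  have h := (hrefl α hα α hα).2
  rw [mul_div_assoc, div_self hpos.ne', mul_one, two_smul] at h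
  simpa using h

/-- If `β + a` and `β + a + b` are roots and `a + b` is neither a root nor zero, then the roots
`a` and `b` may be added to `β` in the other order. -/
theorem IsRootSystem.add_mem_or_eq_zero_of_swap {R : Set V} (hR : IsRootSystem R) {β a b : V}
    (hβ : β ∈ R) (ha : a ∈ R) (hb : b ∈ R) (hβa : β + a ∈ R) (hβab : β + a + b ∈ R)
    (hab : a + b ∉ R) (hab0 : a + b ≠ 0) : β + b ∈ R ∨ β + b = 0 := by
  by_contra! hc
  have obtuse : ∀ {x y : V}, x ∈ R → y ∈ R → x + y ∉ R → x + y ≠ 0 → 0 ≤ ⟪x, y⟫ := by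
    intro x y hx hy h h0
    by_contra! hlt
    exact (hR.add_mem_or_eq_zero hx hy hlt).elim h h0
  have h1 := obtuse ha hb hab hab0
  have h2 := obtuse hβ hb hc.1 hc.2
  have eab : -β + (β + a + b) = a + b := by abel
  have eβb : -a + (β + a + b) = β + b := by abel
  have h3 := obtuse (hR.neg_mem hβ) hβab (eab ▸ hab) (eab ▸ hab0)
  have h4 := obtuse (hR.neg_mem ha) hβab (eβb ▸ hc.1) (eβb ▸ hc.2)
  have h5 : β + a = 0 := by
    rw [← real_inner_self_nonpos]
    simp only [inner_add_left, inner_add_right, inner_neg_left, real_inner_comm β a] at *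
    linarith
  exact hR.2.1 (h5 ▸ hβa)

/-- `LeviReach R ξ η k β`: adding successively `k` roots on which `η` is nonpositive leads from `β`,
through roots, to an element on which both `ξ` and `η` are positive. -/
def LeviReach (R : Set V) (ξ η : V →ₗ[ℝ] ℝ) : ℕ → V → Prop
  | 0, β => 0 < ξ β ∧ 0 < η β
  | k + 1, β => ∃ a ∈ R, η a ≤ 0 ∧ β + a ∈ R ∧ LeviReach R ξ η k (β + a)

theorem LeviReach.pos {R : Set V} {ξ η : V →ₗ[ℝ] ℝ} {k : ℕ} {β : V}
    (h : LeviReach R ξ η k β) : 0 < η β := by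
  induction k generalizing β with
  | zero => exact h.2
  | succ k ih =>
    obtain ⟨a, -, hηa, -, h⟩ := h
    have := ih h
    rw [map_add] at this
    linarith

/-- A step along which `ξ` does not increase can be avoided. -/
theorem LeviReach.shorten {R : Set V} (hR : IsRootSystem R) {ξ η : V →ₗ[ℝ] ℝ} {k : ℕ} {β a : V}
    (hβ : β ∈ R) (ha : a ∈ R) (hξa : ξ a ≤ 0) (hηa : η a ≤ 0) (hβa : β + a ∈ R)
    (h : LeviReach R ξ η k (β + a)) : ∃ j ≤ k, LeviReach R ξ η j β := by
  induction k generalizing β with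
  | zero =>
    obtain ⟨h1, h2⟩ := h
    rw [map_add] at h1 h2
    exact ⟨0, le_rfl, by linarith, by linarith⟩
  | succ k ih =>
    obtain ⟨b, hb, hηb, hβab, h⟩ := h
    by_cases hab : a + b ∈ R
    · rw [add_assoc] at hβab h
      exact ⟨k + 1, le_rfl, a + b, hab, by rw [map_add]; linarith, hβab, h⟩
    by_cases hab0 : a + b = 0
    · rw [add_assoc, hab0, add_zero] at h
      exact ⟨k, k.le_succ, h⟩
    have hpos := h.pos
    rw [add_right_comm] at h
    rcases hR.add_mem_or_eq_zero_of_swap hβ ha hb hβa hβab hab hab0 with hβb | hβb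
    · rw [add_right_comm] at hβab
      obtain ⟨j, hj, h'⟩ := ih hβb hβab h
      exact ⟨j + 1, by lia, b, hb, hηb, hβb, h'⟩
    · rw [add_right_comm, hβb, zero_add] at hpos
      linarith

theorem LeviReach.exists_le_one_sub {R : Set V} (hR : IsRootSystem R) {ξ η : V →ₗ[ℝ] ℝ}
    (hξ : ∀ α ∈ R, ∃ n : ℤ, ξ α = (n : ℝ)) {k : ℕ} {β : V} (hβ : β ∈ R) (hξβ : ξ β ≤ 0)
    (h : LeviReach R ξ η k β) : ∃ j : ℕ, (j : ℝ) ≤ 1 - ξ β ∧ LeviReach R ξ η j β := by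
  induction k using Nat.strong_induction_on generalizing β with
  | _ k ih =>
    cases k with
    | zero => exact absurd h.1 hξβ.not_gt
    | succ k =>
      obtain ⟨a, ha, hηa, hβa, h⟩ := h
      rcases le_or_gt (ξ a) 0 with hξa | hξa
      · obtain ⟨j, hj, h'⟩ := h.shorten hR hβ ha hξa hηa hβa
        exact ih j (by lia) hβ hξβ h'
      have hone : 1 ≤ ξ a := by
        obtain ⟨n, hn⟩ := hξ a ha
        rw [hn] at hξa ⊢
        exact_mod_cast hξa
      rcases le_or_gt (ξ (β + a)) 0 with hs | hs
      · obtain ⟨j, hj, h'⟩ := ih k k.lt_succ_self hβa hs h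
        rw [map_add] at hj
        exact ⟨j + 1, by push_cast; linarith, a, ha, hηa, hβa, h'⟩
      · exact ⟨1, by push_cast; linarith, a, ha, hηa, hβa, hs, h.pos⟩

@[simp]
theorem partialSum_zero {E : Type*} [NormedAddCommGroup E] (β : E) {k : ℕ} (α : Fin k → E) :
    partialSum β α 0 = β := by
  simp [partialSum]

theorem partialSum_succ {E : Type*} [NormedAddCommGroup E] (β : E) {k : ℕ} (α : Fin (k + 1) → E)
    (h : ℕ) :
    partialSum β α (h + 1) = partialSum (β + α 0) (Fin.tail α) h := by
  simp [partialSum, Finset.sum_filter, Fin.sum_univ_succ, Fin.tail, add_assoc]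

theorem isLeviChain_succ_iff {R Q : Set V} {σ : V →ₗ[ℝ] V} {β : V} {k : ℕ}
    {α : Fin (k + 1) → V} :
    IsLeviChain R Q σ β α ↔ (α 0 ∈ R ∧ σ (α 0) ∈ Q) ∧ β + α 0 ∈ R ∧
      IsLeviChain R Q σ (β + α 0) (Fin.tail α) := by
  simp only [IsLeviChain, Fin.forall_fin_succ, partialSum_succ]
  constructor
  · rintro ⟨⟨h0, hα⟩, hsum, hend⟩
    have hsum' : ∀ h ≤ k, partialSum (β + α 0) (Fin.tail α) h ∈ R := fun h hh => by
      simpa only [partialSum_succ] using hsum (h + 1) (by lia) (by lia)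
    exact ⟨h0, by simpa using hsum' 0 k.zero_le, hα, fun h _ hh => hsum' h hh, hend⟩
  · rintro ⟨h0, hβ, hα, hsum, hend⟩
    refine ⟨⟨h0, hα⟩, fun h h1 hh => ?_, hend⟩
    obtain ⟨h, rfl⟩ := Nat.exists_eq_add_of_le' h1
    rw [partialSum_succ]
    rcases h.eq_zero_or_pos with rfl | hpos
    · simpa using hβ
    · exact hsum h hpos (by lia)

theorem exists_isLeviChain_iff {R : Set V} {ξ : V →ₗ[ℝ] ℝ} {σ : V →ₗ[ℝ] V}
    (hσ : Set.MapsTo σ R R) {k : ℕ} {β : V} (hβ : β ∈ R) :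
    (∃ α : Fin k → V, IsLeviChain R {α ∈ R | ξ α ≤ 0} σ β α) ↔ LeviReach R ξ (ξ ∘ₗ σ) k β := by
  induction k generalizing β with
  | zero =>
    simp only [IsLeviChain, LeviReach, partialSum_zero, Set.mem_ofPred_eq, hβ, hσ hβ, true_and,
      not_le, LinearMap.comp_apply]
    exact ⟨fun ⟨_, h⟩ => h.2.2, fun h => ⟨0, fun i => i.elim0, fun _ h1 h0 => by lia, h⟩⟩
  | succ k ih =>
    simp only [isLeviChain_succ_iff]
    constructor
    · rintro ⟨α, ⟨h0, h0'⟩, hs, h⟩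
      exact ⟨α 0, h0, h0'.2, hs, (ih hs).1 ⟨_, h⟩⟩
    · rintro ⟨a, ha, ha', hs, h⟩
      obtain ⟨α, hα⟩ := (ih hs).2 h
      exact ⟨Fin.cons a α, by simpa using ⟨ha, hσ ha, ha'⟩, by simpa using hs, by simpa using hα⟩

/-- If `β ∈ Q` with `σ(β) ∉ Q` has finite Levi order, then `q^σ(β) ≤ 1 − ξ(β)`. -/
theorem leviOrder_le_one_sub_xi
    (R : Set V) (hR : IsRootSystem R)
    (ξ : V →ₗ[ℝ] ℝ) (hξ : ∀ α ∈ R, ∃ n : ℤ, ξ α = (n : ℝ))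
    (Q : Set V) (hQ : Q = {α ∈ R | ξ α ≤ 0})
    (σ : V →ₗ[ℝ] V) (hσ : σ ∘ₗ σ = LinearMap.id) (hσR : σ '' R = R)
    (β : V) (hβ : β ∈ Q) (hσβ : σ β ∉ Q)
    (hfin : leviOrder R Q σ β ≠ ⊤) :
    ∃ k : ℕ, leviOrder R Q σ β = (k : ℕ∞) ∧ (k : ℝ) ≤ 1 - ξ β := by
  subst hQ
  have hmap : Set.MapsTo σ R R := Set.mapsTo_iff_image_subset.2 hσR.le
  obtain ⟨_, k, α, rfl, hα⟩ : {m : ℕ∞ | ∃ (k : ℕ) (α : Fin k → V), m = (k : ℕ∞) ∧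
      IsLeviChain R {α ∈ R | ξ α ≤ 0} σ β α}.Nonempty := by
    by_contra! hempty
    exact hfin (by rw [leviOrder, hempty, sInf_empty])
  obtain ⟨j, hj, hreach⟩ := ((exists_isLeviChain_iff hmap hβ.1).1 ⟨α, hα⟩).exists_le_one_sub
    hR hξ hβ.1 hβ.2
  obtain ⟨α', hα'⟩ := (exists_isLeviChain_iff hmap hβ.1).2 hreach
  have hle : leviOrder R {α ∈ R | ξ α ≤ 0} σ β ≤ j := sInf_le ⟨j, α', rfl, hα'⟩
  obtain ⟨m, hm⟩ := ENat.ne_top_iff_exists.1 hfin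
  refine ⟨m, hm.symm, ?_⟩
  rw [← hm] at hle
  have : (m : ℝ) ≤ j := by exact_mod_cast hle
  exact this.trans hj
end

section
/- For every integer k ≥ 1 there exist a finite-dimensional complex Lie algebra g, a conjugation σ of g, and a complex Lie subalgebra q of g such that q + σ(q) generates g as a Lie algebra and the descending contact chain satisfies q^{k−1} ≠ q^{k} = q ∩ σ(q), i.e. (g, σ, q) is contact nondegenerate of order exactly k. -/
open Pointwise

/-- A conjugation of a complex Lie algebra `g`: an involutive, additive,
conjugate-linear map commuting with the bracket. -/
structure Conjugation (g : Type*) [LieRing g] [LieAlgebra ℂ g] where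
  toFun : g → g
  involutive : ∀ x, toFun (toFun x) = x
  map_add' : ∀ x y, toFun (x + y) = toFun x + toFun y
  map_smul' : ∀ (c : ℂ) (x : g), toFun (c • x) = (starRingEnd ℂ) c • toFun x
  map_bracket' : ∀ x y, toFun ⁅x, y⁆ = ⁅toFun x, toFun y⁆

variable {g : Type*} [LieRing g] [LieAlgebra ℂ g]

/-- The descending contact chain of `(g, σ, q)`:
`q^{0} = q` and `q^{p} = {Z ∈ q^{p-1} : [Z, q + σ(q)] ⊆ q^{p-1} + σ(q)}`. -/
def contactChain (σ : Conjugation g) (q : LieSubalgebra ℂ g) : ℕ → Set g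
  | 0 => (q : Set g)
  | p + 1 =>
      {Z ∈ contactChain σ q p |
        ∀ W ∈ (q : Set g) + σ.toFun '' (q : Set g),
          ⁅Z, W⁆ ∈ contactChain σ q p + σ.toFun '' (q : Set g)}

/-- The left shift `(u₀, …, uₙ₋₁) ↦ (u₁, …, uₙ₋₁, 0)` on `ℂⁿ`. -/
def leftShift (n : ℕ) : (Fin n → ℂ) →ₗ[ℂ] (Fin n → ℂ) where
  toFun u i := if h : (i : ℕ) + 1 < n then u ⟨i + 1, h⟩ else 0
  map_add' u v := by
    ext i
    by_cases h : (i : ℕ) + 1 < n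
    · simp only [dif_pos h, Pi.add_apply]
    · simp only [dif_neg h, Pi.add_apply, add_zero]
  map_smul' c u := by
    ext i
    by_cases h : (i : ℕ) + 1 < n <;> simp [h]

theorem leftShift_apply {n : ℕ} (u : Fin n → ℂ) (i : Fin n) :
    leftShift n u i = if h : (i : ℕ) + 1 < n then u ⟨i + 1, h⟩ else 0 :=
  rfl

theorem leftShift_star {n : ℕ} (u : Fin n → ℂ) : leftShift n (star u) = star (leftShift n u) := by
  ext i
  by_cases h : (i : ℕ) + 1 < n <;> simp [leftShift_apply, h]

theorem leftShift_single_one (n : ℕ) (c : ℂ) :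
    leftShift (n + 2) (Pi.single 1 c) = Pi.single 0 c := by
  ext i
  by_cases h : (i : ℕ) + 1 < n + 2
  · have hi : (⟨i + 1, h⟩ : Fin (n + 2)) = 1 ↔ i = 0 := by
      rw [Fin.ext_iff, Fin.ext_iff, Fin.val_one, Fin.val_zero]
      exact Nat.add_eq_right
    simp only [leftShift_apply, dif_pos h, Pi.single_apply, hi]
  · have hi : i ≠ 0 := by
      rintro rfl
      simp at h
    simp [leftShift_apply, h, hi]

/-- The underlying space `ℂ × ℂⁿ` of the semidirect sum `ℂ ⋉ ℂⁿ` in which the generator of `ℂ`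
acts on `ℂⁿ` by the left shift. -/
def ShiftAlgebra (n : ℕ) : Type :=
  ℂ × (Fin n → ℂ)

namespace ShiftAlgebra

variable {n : ℕ}

noncomputable instance : AddCommGroup (ShiftAlgebra n) :=
  inferInstanceAs (AddCommGroup (ℂ × (Fin n → ℂ)))

noncomputable instance : Module ℂ (ShiftAlgebra n) :=
  inferInstanceAs (Module ℂ (ℂ × (Fin n → ℂ)))

instance : FiniteDimensional ℂ (ShiftAlgebra n) :=
  inferInstanceAs (FiniteDimensional ℂ (ℂ × (Fin n → ℂ)))

/-- The component in `ℂ`. -/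
def scalar (x : ShiftAlgebra n) : ℂ := x.1

/-- The component in `ℂⁿ`. -/
def vec (x : ShiftAlgebra n) : Fin n → ℂ := x.2

/-- The element with given components. -/
def mk (a : ℂ) (u : Fin n → ℂ) : ShiftAlgebra n := (a, u)

@[ext] theorem ext {x y : ShiftAlgebra n} (h : x.scalar = y.scalar) (h' : x.vec = y.vec) : x = y :=
  Prod.ext h h'

@[simp] theorem scalar_mk (a : ℂ) (u : Fin n → ℂ) : (mk a u).scalar = a := rfl
@[simp] theorem vec_mk (a : ℂ) (u : Fin n → ℂ) : (mk a u).vec = u := rfl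
@[simp] theorem scalar_zero : (0 : ShiftAlgebra n).scalar = 0 := rfl
@[simp] theorem vec_zero : (0 : ShiftAlgebra n).vec = 0 := rfl
@[simp] theorem scalar_add (x y : ShiftAlgebra n) : (x + y).scalar = x.scalar + y.scalar := rfl
@[simp] theorem vec_add (x y : ShiftAlgebra n) : (x + y).vec = x.vec + y.vec := rfl
@[simp] theorem scalar_smul (c : ℂ) (x : ShiftAlgebra n) : (c • x).scalar = c * x.scalar := rfl
@[simp] theorem vec_smul (c : ℂ) (x : ShiftAlgebra n) : (c • x).vec = c • x.vec := rfl

noncomputable instance : Bracket (ShiftAlgebra n) (ShiftAlgebra n) where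
  bracket x y := mk 0 (x.scalar • leftShift n y.vec - y.scalar • leftShift n x.vec)

@[simp] theorem scalar_lie (x y : ShiftAlgebra n) : ⁅x, y⁆.scalar = 0 := rfl

@[simp] theorem vec_lie (x y : ShiftAlgebra n) :
    ⁅x, y⁆.vec = x.scalar • leftShift n y.vec - y.scalar • leftShift n x.vec := rfl

noncomputable instance : LieRing (ShiftAlgebra n) where
  add_lie x y z := by
    ext1 <;> simp
    module
  lie_add x y z := by
    ext1 <;> simp
    module
  lie_self x := by ext1 <;> simp
  leibniz_lie x y z := by
    ext1 <;> simp
    module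

noncomputable instance : LieAlgebra ℂ (ShiftAlgebra n) where
  lie_smul c x y := by
    ext1 <;> simp
    module

/-- Coordinatewise complex conjugation. -/
noncomputable def conj (x : ShiftAlgebra n) : ShiftAlgebra n := mk (star x.scalar) (star x.vec)

@[simp] theorem scalar_conj (x : ShiftAlgebra n) : x.conj.scalar = star x.scalar := rfl
@[simp] theorem vec_conj (x : ShiftAlgebra n) : x.conj.vec = star x.vec := rfl

/-- The conjugation `(x, y) ↦ (ȳ, x̄)` of `ShiftAlgebra n × ShiftAlgebra n`. -/
noncomputable def swapConj (n : ℕ) : Conjugation (ShiftAlgebra n × ShiftAlgebra n) where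
  toFun z := (z.2.conj, z.1.conj)
  involutive z := by ext1 <;> ext1 <;> simp
  map_add' x y := by ext1 <;> ext1 <;> simp
  map_smul' c x := by ext1 <;> ext1 <;> simp
  map_bracket' x y := by ext1 <;> ext1 <;> simp [leftShift_star]

/-- The abelian subalgebra of all pairs `((0, u), (c, 0))` with `u₀ = 0`. -/
def crSubalgebra (n : ℕ) : LieSubalgebra ℂ (ShiftAlgebra (n + 2) × ShiftAlgebra (n + 2)) where
  carrier := {z | z.1.scalar = 0 ∧ z.1.vec 0 = 0 ∧ z.2.vec = 0}
  add_mem' := by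
    rintro x y ⟨h₁, h₂, h₃⟩ ⟨h₄, h₅, h₆⟩
    simp [h₁, h₂, h₃, h₄, h₅, h₆]
  zero_mem' := by simp
  smul_mem' := by
    rintro c x ⟨h₁, h₂, h₃⟩
    simp [h₁, h₂, h₃]
  lie_mem' := by
    rintro x y ⟨h₁, h₂, h₃⟩ ⟨h₄, h₅, h₆⟩
    simp [h₁, h₃, h₄, h₆]

theorem mem_crSubalgebra {z : ShiftAlgebra (n + 2) × ShiftAlgebra (n + 2)} :
    z ∈ crSubalgebra n ↔ z.1.scalar = 0 ∧ z.1.vec 0 = 0 ∧ z.2.vec = 0 :=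
  Iff.rfl

theorem mem_swapConj_image {z : ShiftAlgebra (n + 2) × ShiftAlgebra (n + 2)} :
    z ∈ (swapConj (n + 2)).toFun '' (crSubalgebra n : Set _) ↔
      z.2.scalar = 0 ∧ z.2.vec 0 = 0 ∧ z.1.vec = 0 := by
  constructor
  · rintro ⟨w, ⟨h₁, h₂, h₃⟩, rfl⟩
    simp [swapConj, h₁, h₂, h₃]
  · rintro ⟨h₁, h₂, h₃⟩
    refine ⟨(swapConj (n + 2)).toFun z, ?_, (swapConj (n + 2)).involutive z⟩
    rw [SetLike.mem_coe, mem_crSubalgebra]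
    simp [swapConj, h₁, h₂, h₃]

theorem mem_add_swapConj_image {z : ShiftAlgebra (n + 2) × ShiftAlgebra (n + 2)} :
    z ∈ (crSubalgebra n : Set _) + (swapConj (n + 2)).toFun '' (crSubalgebra n : Set _) ↔
      z.1.vec 0 = 0 ∧ z.2.vec 0 = 0 := by
  rw [Set.mem_add]
  constructor
  · rintro ⟨x, hx, y, hy, rfl⟩
    rw [SetLike.mem_coe, mem_crSubalgebra] at hx
    rw [mem_swapConj_image] at hy
    simp [hx, hy]
  · rintro ⟨h₁, h₂⟩
    refine ⟨(mk 0 z.1.vec, mk z.2.scalar 0), ?_, (mk z.1.scalar 0, mk 0 z.2.vec), ?_, ?_⟩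
    · simp [mem_crSubalgebra, h₁]
    · exact mem_swapConj_image.2 (by simp [h₂])
    · ext1 <;> ext1 <;> simp

theorem lieSpan_crSubalgebra_add_swapConj_image (n : ℕ) :
    LieSubalgebra.lieSpan ℂ _
      ((crSubalgebra n : Set _) + (swapConj (n + 2)).toFun '' (crSubalgebra n : Set _)) = ⊤ := by
  rw [eq_top_iff]
  rintro z -
  have hz : z = (mk z.1.scalar (z.1.vec - Pi.single 0 (z.1.vec 0)),
        mk z.2.scalar (z.2.vec - Pi.single 0 (z.2.vec 0))) +
      ⁅((mk 1 0, mk 1 0) : ShiftAlgebra (n + 2) × ShiftAlgebra (n + 2)),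
        ((mk 0 (Pi.single 1 (z.1.vec 0)), mk 0 (Pi.single 1 (z.2.vec 0))) :
          ShiftAlgebra (n + 2) × ShiftAlgebra (n + 2))⁆ := by
    ext1 <;> ext1 <;> simp [leftShift_single_one]
  rw [hz]
  refine add_mem ?_ (LieSubalgebra.lie_mem _ ?_ ?_) <;>
  · apply LieSubalgebra.subset_lieSpan
    rw [mem_add_swapConj_image]
    simp

theorem lie_eq_of_mem_crSubalgebra {z : ShiftAlgebra (n + 2) × ShiftAlgebra (n + 2)}
    (hz : z ∈ crSubalgebra n) (w : ShiftAlgebra (n + 2) × ShiftAlgebra (n + 2)) :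
    ⁅z, w⁆ = (mk 0 (-w.1.scalar • leftShift _ z.1.vec), mk 0 (z.2.scalar • leftShift _ w.2.vec)) := by
  obtain ⟨h₁, -, h₃⟩ := hz
  ext1 <;> ext1 <;> simp [h₁, h₃]

theorem leftShift_eq_zero_iff_le {p : ℕ} {u : Fin (n + 2) → ℂ} (h₀ : u 0 = 0) :
    (∀ i : Fin (n + 2), (i : ℕ) ≤ p → leftShift _ u i = 0) ↔
      ∀ i : Fin (n + 2), (i : ℕ) ≤ p + 1 → u i = 0 := by
  constructor
  · rintro h ⟨_ | i, hi⟩ hip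
    · exact h₀
    · simpa [leftShift_apply, hi] using h ⟨i, by omega⟩ (by simpa using hip)
  · intro h i hip
    rw [leftShift_apply]
    split_ifs with hi
    · exact h _ (by simpa using hip)
    · rfl

theorem mem_contactChain_one {z : ShiftAlgebra (n + 2) × ShiftAlgebra (n + 2)} :
    z ∈ contactChain (swapConj (n + 2)) (crSubalgebra n) 1 ↔
      z.1.scalar = 0 ∧ (∀ i : Fin (n + 2), (i : ℕ) ≤ 1 → z.1.vec i = 0) ∧ z.2 = 0 := by
  simp only [contactChain, Set.mem_ofPred_eq, mem_add_swapConj_image, SetLike.mem_coe]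
  constructor
  · rintro ⟨hz, h⟩
    obtain ⟨h₁, h₂, h₃⟩ := id hz
    have key := h (mk 1 0, mk 0 (Pi.single 1 1)) (by simp)
    rw [lie_eq_of_mem_crSubalgebra hz] at key
    simp only [scalar_mk, vec_mk, leftShift_single_one] at key
    refine ⟨h₁, (leftShift_eq_zero_iff_le h₂).1 fun i hi ↦ ?_, ?_⟩
    · obtain rfl : i = 0 := by ext; simpa using hi
      simpa using key.1
    · ext1
      · simpa using key.2
      · exact h₃
  · rintro ⟨h₁, h₂, h₃⟩
    have h₀ : z.1.vec 0 = 0 := h₂ 0 (by simp)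
    have hz : z ∈ crSubalgebra n := ⟨h₁, h₀, by simp [h₃]⟩
    refine ⟨hz, fun w _ ↦ ?_⟩
    rw [lie_eq_of_mem_crSubalgebra hz]
    have hshift : leftShift _ z.1.vec 0 = 0 := (leftShift_eq_zero_iff_le h₀).2 h₂ 0 le_rfl
    simp [h₃, hshift]

theorem mem_contactChain_succ {p : ℕ} {z : ShiftAlgebra (n + 2) × ShiftAlgebra (n + 2)} :
    z ∈ contactChain (swapConj (n + 2)) (crSubalgebra n) (p + 1) ↔
      z.1.scalar = 0 ∧ (∀ i : Fin (n + 2), (i : ℕ) ≤ p + 1 → z.1.vec i = 0) ∧ z.2 = 0 := by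
  induction p generalizing z with
  | zero => exact mem_contactChain_one
  | succ p ih =>
    rw [contactChain]
    simp only [Set.mem_ofPred_eq, mem_add_swapConj_image]
    constructor
    · rintro ⟨hz, h⟩
      obtain ⟨h₁, h₂, h₃⟩ := ih.1 hz
      have h₀ : z.1.vec 0 = 0 := h₂ 0 (by simp)
      obtain ⟨x, hx, y, hy, hxy⟩ := Set.mem_add.1 (h (mk 1 0, 0) (by simp))
      rw [lie_eq_of_mem_crSubalgebra ⟨h₁, h₀, by simp [h₃]⟩] at hxy
      refine ⟨h₁, (leftShift_eq_zero_iff_le h₀).1 fun i hi ↦ ?_, h₃⟩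
      have hvec := congrArg (fun v ↦ v.1.vec i) hxy
      simpa [(ih.1 hx).2.1 i hi, (mem_swapConj_image.1 hy).2.2] using hvec.symm
    · rintro ⟨h₁, h₂, h₃⟩
      have h₀ : z.1.vec 0 = 0 := h₂ 0 (by simp)
      refine ⟨ih.2 ⟨h₁, fun i hi ↦ h₂ i (by omega), h₃⟩, fun w _ ↦ ?_⟩
      refine Set.mem_add.2 ⟨⁅z, w⁆, ih.2 ?_, 0, mem_swapConj_image.2 (by simp), add_zero _⟩
      rw [lie_eq_of_mem_crSubalgebra ⟨h₁, h₀, by simp [h₃]⟩]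
      refine ⟨rfl, fun i hi ↦ ?_, ?_⟩
      · simp [(leftShift_eq_zero_iff_le h₀).2 h₂ i hi]
      · ext1 <;> simp [h₃]

theorem contactChain_ne_succ (n : ℕ) :
    contactChain (swapConj (n + 2)) (crSubalgebra n) n ≠
      contactChain (swapConj (n + 2)) (crSubalgebra n) (n + 1) := by
  intro h
  have hlast : ((mk 0 (Pi.single (Fin.last (n + 1)) 1), 0) :
      ShiftAlgebra (n + 2) × ShiftAlgebra (n + 2)) ∈
        contactChain (swapConj (n + 2)) (crSubalgebra n) n := by
    cases n with
    | zero =>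
      rw [contactChain, SetLike.mem_coe, mem_crSubalgebra]
      simp
    | succ n =>
      rw [mem_contactChain_succ]
      refine ⟨rfl, fun i hi ↦ ?_, rfl⟩
      have hne : i ≠ Fin.last (n + 1 + 1) := by
        rintro rfl
        simp at hi
      simp [hne]
  rw [h, mem_contactChain_succ] at hlast
  simpa using hlast.2.1 (Fin.last (n + 1)) (by simp)

theorem contactChain_eq_inter (n : ℕ) :
    contactChain (swapConj (n + 2)) (crSubalgebra n) (n + 1) =
      (crSubalgebra n : Set _) ∩ (swapConj (n + 2)).toFun '' (crSubalgebra n : Set _) := by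
  ext z
  rw [mem_contactChain_succ, Set.mem_inter_iff, SetLike.mem_coe, mem_crSubalgebra,
    mem_swapConj_image]
  constructor
  · rintro ⟨h₁, h₂, h₃⟩
    have hvec : z.1.vec = 0 := funext fun i ↦ h₂ i (by omega)
    simp [h₁, h₃, hvec]
  · rintro ⟨⟨h₁, -, h₂⟩, h₃, -, h₄⟩
    exact ⟨h₁, by simp [h₄], ext h₃ h₂⟩

end ShiftAlgebra

/-- For every integer `k ≥ 1` there is a finite-dimensional complex Lie algebra with a
conjugation and a complex Lie subalgebra giving a fundamental `CR` algebra which is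
contact nondegenerate of order exactly `k`. -/
theorem exists_contactNondegenerate_of_order (k : ℕ) (hk : 1 ≤ k) :
    ∃ (g : Type) (_ : LieRing g) (_ : LieAlgebra ℂ g) (_ : FiniteDimensional ℂ g)
      (σ : Conjugation g) (q : LieSubalgebra ℂ g),
      LieSubalgebra.lieSpan ℂ g ((q : Set g) + σ.toFun '' (q : Set g)) = ⊤ ∧
      contactChain σ q (k - 1) ≠ contactChain σ q k ∧
      contactChain σ q k = (q : Set g) ∩ σ.toFun '' (q : Set g) := by
  obtain ⟨n, rfl⟩ : ∃ n, k = n + 1 := ⟨k - 1, by omega⟩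
  exact ⟨ShiftAlgebra (n + 2) × ShiftAlgebra (n + 2), inferInstance, inferInstance, inferInstance,
    ShiftAlgebra.swapConj (n + 2), ShiftAlgebra.crSubalgebra n,
    ShiftAlgebra.lieSpan_crSubalgebra_add_swapConj_image n,
    ShiftAlgebra.contactChain_ne_succ n, ShiftAlgebra.contactChain_eq_inter n⟩
end
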